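/- Let C be a locally presentable category with a cofibrantly generated weak factorization system (L, R) such that ∅ → X lies in L for every object X, equipped with an exact cylinder I and a class An(I) of right I-anodyne extensions. Then a morphism i : K → M in the class L with right I-fibrant codomain M is a weak equivalence (i.e., induces bijections i* : [M, W]_I → [K, W]_I for all right I-fibrant W) if and only if it is a right I-anodyne extension. -/

import Mathlib

set_option linter.unusedSectionVars false

open CategoryTheory CategoryTheory.Limits

universe v u

namespace Paper

variable {C : Type u} [Category.{v} C]

/-- The class of morphisms having the left lifting property against every morphism in `T`. -/
def llp (T : MorphismProperty C) : MorphismProperty C :=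
  fun _ _ f => ∀ ⦃X Y : C⦄ (g : X ⟶ Y), T g → HasLiftingProperty f g

/-- The class of morphisms having the right lifting property against every morphism in `T`. -/
def rlp (T : MorphismProperty C) : MorphismProperty C :=
  fun _ _ g => ∀ ⦃A B : C⦄ (f : A ⟶ B), T f → HasLiftingProperty f g

/-- The morphism property associated to a set of arrows. -/
def ofArrows (S : Set (Arrow C)) : MorphismProperty C :=
  fun _ _ f => Arrow.mk f ∈ S

/-- A (possibly large) category `J` is `κ`-filtered if every diagram in `J` indexed by a
small category of size `< κ` admits a cocone. -/
def IsCardinalFiltered (J : Cat.{v, v}) (κ : Cardinal.{v}) : Prop :=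
  ∀ K : Cat.{v, v}, Cardinal.mk (Arrow K) < κ → ∀ F : K ⥤ J, Nonempty (Cocone F)

/-- An object `X` is `κ`-presentable if `Hom(X, -)` preserves colimits of `κ`-filtered
diagrams. -/
def IsPresentableObj (κ : Cardinal.{v}) (X : C) : Prop :=
  ∀ J : Cat.{v, v}, IsCardinalFiltered J κ →
    PreservesColimitsOfShape J (coyoneda.obj (Opposite.op X))

/-- A category is locally presentable if it is cocomplete and there is a regular cardinal `κ`
and a small family of `κ`-presentable objects such that every object is a `κ`-filtered colimit
of objects of the family. -/
class LocallyPresentable (C : Type u) [Category.{v} C] extends HasColimits C : Prop where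
  exists_presentable_generator :
    ∃ κ : Cardinal.{v}, κ.IsRegular ∧
      ∃ (ι : Type v) (G : ι → C), (∀ i, IsPresentableObj κ (G i)) ∧
        ∀ X : C, ∃ (J : Cat.{v, v}) (F : J ⥤ C) (c : Cocone F),
          IsCardinalFiltered J κ ∧ Nonempty (IsColimit c) ∧
          (∀ j : J, ∃ i, Nonempty (F.obj j ≅ G i)) ∧ Nonempty (c.pt ≅ X)

/-- `(L, R)` is a cofibrantly generated weak factorization system such that every morphism
from the initial object is in `L`. -/
structure IsCofGenWFS [HasColimits C] (L R : MorphismProperty C) : Prop where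
  exists_generating_set : ∃ S : Set (Arrow C), Small.{v} S ∧ L = llp (rlp (ofArrows S))
  rlp_eq : R = rlp L
  factorization : ∀ ⦃X Y : C⦄ (f : X ⟶ Y),
    ∃ (Z : C) (i : X ⟶ Z) (p : Z ⟶ Y), L i ∧ R p ∧ i ≫ p = f
  initial_mem : ∀ X : C, L (initial.to X)

/-- A functorial cylinder on `C`. -/
structure Cylinder (C : Type u) [Category.{v} C] where
  I : C ⥤ C
  d0 : 𝟭 C ⟶ I
  d1 : 𝟭 C ⟶ I
  σ : I ⟶ 𝟭 C
  d0_σ : ∀ X : C, d0.app X ≫ σ.app X = 𝟙 X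
  d1_σ : ∀ X : C, d1.app X ≫ σ.app X = 𝟙 X

namespace Cylinder

variable (E : Cylinder C)

lemma d0_naturality' {K M : C} (f : K ⟶ M) :
    f ≫ E.d0.app M = E.d0.app K ≫ E.I.map f := by
  simpa using E.d0.naturality f

lemma d1_naturality' {K M : C} (f : K ⟶ M) :
    f ≫ E.d1.app M = E.d1.app K ≫ E.I.map f := by
  simpa using E.d1.naturality f

variable [HasColimits C]

/-- The canonical map `X ⊔ X ⟶ I(X)`. -/
noncomputable def ι (X : C) : X ⨿ X ⟶ E.I.obj X :=
  coprod.desc (E.d0.app X) (E.d1.app X)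

lemma ι_naturality {K M : C} (f : K ⟶ M) :
    coprod.map f f ≫ E.ι M = E.ι K ≫ E.I.map f := by
  have h0 := E.d0.naturality f
  have h1 := E.d1.naturality f
  simp only [Functor.id_map] at h0 h1
  apply coprod.hom_ext <;> simp [ι, h0, h1]

/-- The pushout-corner map `∂I ⊠ f : (M ⊔ M) ⊔_{K ⊔ K} I(K) ⟶ I(M)`. -/
noncomputable def boundaryBox {K M : C} (f : K ⟶ M) :
    pushout (coprod.map f f) (E.ι K) ⟶ E.I.obj M :=
  pushout.desc (E.ι M) (E.I.map f) (E.ι_naturality f)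

/-- The pushout-corner map `∂0 ⊠ f : M ⊔_K I(K) ⟶ I(M)`. -/
noncomputable def box0 {K M : C} (f : K ⟶ M) :
    pushout f (E.d0.app K) ⟶ E.I.obj M :=
  pushout.desc (E.d0.app M) (E.I.map f) (E.d0_naturality' f)

/-- The pushout-corner map `∂1 ⊠ f : M ⊔_K I(K) ⟶ I(M)`. -/
noncomputable def box1 {K M : C} (f : K ⟶ M) :
    pushout f (E.d1.app K) ⟶ E.I.obj M :=
  pushout.desc (E.d1.app M) (E.I.map f) (E.d1_naturality' f)

end Cylinder

/-- A cylinder is exact with respect to the class `L` if it preserves small colimits,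
the maps `X ⊔ X ⟶ I(X)` are in `L`, and the pushout-corner maps of morphisms of `L` are
again in `L`. -/
structure IsExactCylinder [HasColimits C] (E : Cylinder C) (L : MorphismProperty C) : Prop where
  preservesColimits : PreservesColimits E.I
  ι_mem : ∀ X : C, L (E.ι X)
  boundaryBox_mem : ∀ ⦃K M : C⦄ (f : K ⟶ M), L f → L (E.boundaryBox f)
  box0_mem : ∀ ⦃K M : C⦄ (f : K ⟶ M), L f → L (E.box0 f)
  box1_mem : ∀ ⦃K M : C⦄ (f : K ⟶ M), L f → L (E.box1 f)

/-- `An` is a class of right `I`-anodyne extensions. -/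
structure IsRightAnodyneClass [HasColimits C] (E : Cylinder C) (L : MorphismProperty C)
    (An : MorphismProperty C) : Prop where
  le : An ≤ L
  exists_generating_set : ∃ Λ : Set (Arrow C), Small.{v} Λ ∧ ofArrows Λ ≤ L ∧
    An = llp (rlp (ofArrows Λ))
  box1_mem : ∀ ⦃K M : C⦄ (f : K ⟶ M), L f → An (E.box1 f)
  boundaryBox_mem : ∀ ⦃K M : C⦄ (f : K ⟶ M), An f → An (E.boundaryBox f)

/-- `An` is a class of left `I`-anodyne extensions. -/
structure IsLeftAnodyneClass [HasColimits C] (E : Cylinder C) (L : MorphismProperty C)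
    (An : MorphismProperty C) : Prop where
  le : An ≤ L
  exists_generating_set : ∃ Λ : Set (Arrow C), Small.{v} Λ ∧ ofArrows Λ ≤ L ∧
    An = llp (rlp (ofArrows Λ))
  box0_mem : ∀ ⦃K M : C⦄ (f : K ⟶ M), L f → An (E.box0 f)
  boundaryBox_mem : ∀ ⦃K M : C⦄ (f : K ⟶ M), An f → An (E.boundaryBox f)

/-- A morphism is an `An`-fibration if it has the right lifting property against all
morphisms of `An`. -/
def IsFib (An : MorphismProperty C) {X Y : C} (p : X ⟶ Y) : Prop :=
  ∀ ⦃A B : C⦄ (f : A ⟶ B), An f → HasLiftingProperty f p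

/-- An object `W` is `An`-fibrant if the map `W ⟶ *` has the right lifting property against
all morphisms of `An`, i.e. every morphism to `W` extends along every morphism of `An`. -/
def IsFibrantObj (An : MorphismProperty C) (W : C) : Prop :=
  ∀ ⦃A B : C⦄ (f : A ⟶ B), An f → ∀ a : A ⟶ W, ∃ b : B ⟶ W, f ≫ b = a

namespace Cylinder

variable (E : Cylinder C)

/-- An `I`-homotopy from `f` to `g`. -/
def Homotopy {X Y : C} (f g : X ⟶ Y) : Prop :=
  ∃ h : E.I.obj X ⟶ Y, E.d0.app X ≫ h = f ∧ E.d1.app X ≫ h = g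

/-- `[X, Y]_I`, the quotient of `Hom(X, Y)` by the equivalence relation generated by
`I`-homotopy. -/
def HoHom (X Y : C) : Type v :=
  Quot (fun f g : X ⟶ Y => E.Homotopy f g)

/-- Precomposition `f^* : [B, W]_I ⟶ [A, W]_I`. -/
def precompQ {A B : C} (f : A ⟶ B) (W : C) : E.HoHom B W → E.HoHom A W :=
  Quot.lift (fun g => Quot.mk _ (f ≫ g)) (by
    rintro g g' ⟨h, h0, h1⟩
    apply Quot.sound
    refine ⟨E.I.map f ≫ h, ?_, ?_⟩
    · rw [← Category.assoc, ← E.d0_naturality' f, Category.assoc, h0]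
    · rw [← Category.assoc, ← E.d1_naturality' f, Category.assoc, h1])

end Cylinder

/-- `f` is a weak equivalence if it induces bijections `[B, W]_I ≅ [A, W]_I` for all
fibrant `W`. -/
def IsWeakEq (E : Cylinder C) (An : MorphismProperty C) {A B : C} (f : A ⟶ B) : Prop :=
  ∀ W : C, IsFibrantObj An W → Function.Bijective (E.precompQ f W)

/-- `f` is a retract of `f'`. -/
def IsRetractOf {X Y X' Y' : C} (f : X ⟶ Y) (f' : X' ⟶ Y') : Prop :=
  ∃ (i : X ⟶ X') (r : X' ⟶ X) (j : Y ⟶ Y') (s : Y' ⟶ Y),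
    i ≫ r = 𝟙 X ∧ j ≫ s = 𝟙 Y ∧ i ≫ f' = f ≫ j ∧ f' ≫ s = r ≫ f

/-- A model structure on a category: the classes of weak equivalences, cofibrations and
fibrations, subject to the two-out-of-three, retract, lifting and factorization axioms. -/
structure ModelStructure (C : Type u) [Category.{v} C] where
  weq : MorphismProperty C
  cof : MorphismProperty C
  fib : MorphismProperty C
  weq_id : ∀ X : C, weq (𝟙 X)
  weq_comp : ∀ ⦃X Y Z : C⦄ (f : X ⟶ Y) (g : Y ⟶ Z), weq f → weq g → weq (f ≫ g)
  weq_cancel_left : ∀ ⦃X Y Z : C⦄ (f : X ⟶ Y) (g : Y ⟶ Z), weq f → weq (f ≫ g) → weq g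
  weq_cancel_right : ∀ ⦃X Y Z : C⦄ (f : X ⟶ Y) (g : Y ⟶ Z), weq g → weq (f ≫ g) → weq f
  weq_retract : ∀ ⦃X Y X' Y' : C⦄ (f : X ⟶ Y) (f' : X' ⟶ Y'),
    IsRetractOf f f' → weq f' → weq f
  cof_retract : ∀ ⦃X Y X' Y' : C⦄ (f : X ⟶ Y) (f' : X' ⟶ Y'),
    IsRetractOf f f' → cof f' → cof f
  fib_retract : ∀ ⦃X Y X' Y' : C⦄ (f : X ⟶ Y) (f' : X' ⟶ Y'),
    IsRetractOf f f' → fib f' → fib f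
  lift_trivCof_fib : ∀ ⦃A B X Y : C⦄ (i : A ⟶ B) (p : X ⟶ Y),
    cof i → weq i → fib p → HasLiftingProperty i p
  lift_cof_trivFib : ∀ ⦃A B X Y : C⦄ (i : A ⟶ B) (p : X ⟶ Y),
    cof i → fib p → weq p → HasLiftingProperty i p
  fact_cof_trivFib : ∀ ⦃X Y : C⦄ (f : X ⟶ Y),
    ∃ (Z : C) (i : X ⟶ Z) (p : Z ⟶ Y), cof i ∧ fib p ∧ weq p ∧ i ≫ p = f
  fact_trivCof_fib : ∀ ⦃X Y : C⦄ (f : X ⟶ Y),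
    ∃ (Z : C) (i : X ⟶ Z) (p : Z ⟶ Y), cof i ∧ weq i ∧ fib p ∧ i ≫ p = f

/-- An object `W` is fibrant for a model structure if every morphism to `W` extends along
every trivial cofibration, i.e. `W ⟶ *` has the right lifting property against trivial
cofibrations. -/
def ModelStructure.Fibrant (M : ModelStructure C) (W : C) : Prop :=
  ∀ ⦃A B : C⦄ (i : A ⟶ B), M.cof i → M.weq i → ∀ a : A ⟶ W, ∃ b : B ⟶ W, i ≫ b = a


section SmallObjectArgument

lemma IsPresentableObj.isCardinalPresentable {κ : Cardinal.{v}} [Fact κ.IsRegular] {X : C}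
    (hX : IsPresentableObj κ X) : IsCardinalPresentable X κ where
  preservesColimitOfShape J _ hJ :=
    hX (Cat.of J) fun _ hK F ↦ hJ.nonempty_cocone F ((hasCardinalLT_iff_cardinal_mk_lt _ _).2 hK)

lemma IsCardinalFiltered.isCardinalFiltered {κ : Cardinal.{v}} [Fact κ.IsRegular] {J : Cat.{v, v}}
    (hJ : IsCardinalFiltered J κ) : CategoryTheory.IsCardinalFiltered J κ where
  nonempty_cocone {A _} F hA := hJ (Cat.of A) ((hasCardinalLT_iff_cardinal_mk_lt _ _).1 hA) F

lemma LocallyPresentable.isPresentable [LocallyPresentable C] (X : C) :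
    IsPresentable.{v} X := by
  obtain ⟨κ, hκ, ι, G, hG, h⟩ := LocallyPresentable.exists_presentable_generator (C := C)
  have : Fact κ.IsRegular := ⟨hκ⟩
  have hgen : (isCardinalPresentable C κ).IsCardinalFilteredGenerator κ :=
    { le_isCardinalPresentable := le_rfl
      exists_colimitsOfShape := fun Y ↦ by
        obtain ⟨J, F, c, hJ, ⟨hc⟩, hF, ⟨e⟩⟩ := h Y
        refine ⟨J, inferInstance, hJ.isCardinalFiltered, ?_⟩
        refine ObjectProperty.prop_of_iso _ e
          ⟨{ diag := F, ι := c.ι, isColimit := hc, prop_diag_obj := fun j ↦ ?_ }⟩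
        obtain ⟨i, ⟨e'⟩⟩ := hF j
        have := (hG i).isCardinalPresentable
        exact isCardinalPresentable_of_iso e'.symm κ }
  exact hgen.presentable X

lemma hasSmallObjectArgument_ofArrows [LocallyPresentable C] (S : Set (Arrow C))
    [Small.{v} S] : MorphismProperty.HasSmallObjectArgument.{v} (ofArrows S) := by
  have hpres (f : S) : ∃ (κ : Cardinal.{v}) (_ : Fact κ.IsRegular),
      IsCardinalPresentable f.1.left κ :=
    (LocallyPresentable.isPresentable f.1.left).exists_cardinal
  choose κ₀ hκ₀ hpres using hpres
  obtain ⟨κ, hκ, hlt⟩ := HasCardinalLT.exists_regular_cardinal_forall.{v}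
    (fun f : S ↦ (κ₀ f).ord.ToType)
  have : Fact κ.IsRegular := ⟨hκ⟩
  have : Nonempty κ.ord.ToType := by simpa using hκ.ne_zero
  have := WellFoundedLT.toOrderBot κ.ord.ToType
  have : MorphismProperty.IsSmall.{v} (ofArrows S) :=
    ⟨small_of_injective (β := S) (f := fun f ↦ ⟨f.1, f.2⟩)
      fun _ _ h ↦ Subtype.ext (congrArg Subtype.val h)⟩
  exact ⟨κ, inferInstance, inferInstance,
    { preservesColimit := fun {A B X Y} i hi f hf ↦ by
        have hle : κ₀ ⟨Arrow.mk i, hi⟩ ≤ κ := le_of_lt (by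
          simpa [hasCardinalLT_iff_cardinal_mk_lt] using hlt ⟨Arrow.mk i, hi⟩)
        have : IsCardinalPresentable A (κ₀ ⟨Arrow.mk i, hi⟩) := hpres ⟨Arrow.mk i, hi⟩
        have := isCardinalPresentable_of_le A hle
        have := preservesColimitsOfShape_of_isCardinalPresentable A κ κ.ord.ToType
        infer_instance }⟩

/-- Every morphism factors as a right anodyne extension followed by a right fibration. -/
lemma IsRightAnodyneClass.exists_factorization [LocallyPresentable C] {E : Cylinder C}
    {L An : MorphismProperty C} (hAn : IsRightAnodyneClass E L An) {X Y : C} (f : X ⟶ Y) :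
    ∃ (Z : C) (j : X ⟶ Z) (p : Z ⟶ Y), An j ∧ IsFib An p ∧ j ≫ p = f := by
  obtain ⟨Λ, _, -, rfl⟩ := hAn.exists_generating_set
  have := hasSmallObjectArgument_ofArrows Λ
  let d := MorphismProperty.factorizationData
    (ofArrows Λ).rlp.llp (ofArrows Λ).rlp f
  have hp : rlp (ofArrows Λ) d.p := fun _ _ g hg ↦ d.hp g hg
  exact ⟨d.Z, d.i, d.p, fun _ _ g hg ↦ d.hi g fun _ _ f hf ↦ hg f hf,
    fun _ _ g hg ↦ hg d.p hp, d.fac⟩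

end SmallObjectArgument

lemma IsRightAnodyneClass.of_retract [HasColimits C] {E : Cylinder C} {L An : MorphismProperty C}
    (hAn : IsRightAnodyneClass E L An) {K M N : C} {i : K ⟶ M} {j : K ⟶ N} (hj : An j)
    {p : N ⟶ M} {t : M ⟶ N} (hjp : j ≫ p = i) (hit : i ≫ t = j) (htp : t ≫ p = 𝟙 M) :
    An i := by
  obtain ⟨Λ, -, -, rfl⟩ := hAn.exists_generating_set
  intro X Y g hg
  have := hj g hg
  refine ⟨fun {a b} sq ↦ ?_⟩
  have sq' : CommSq a j g (p ≫ b) := ⟨by rw [sq.w, ← hjp, Category.assoc]⟩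
  exact ⟨⟨{ l := t ≫ sq'.lift
            fac_left := by rw [← Category.assoc, hit, sq'.fac_left]
            fac_right := by
              rw [Category.assoc, sq'.fac_right, ← Category.assoc, htp, Category.id_comp] }⟩⟩

lemma IsFibrantObj.of_isFib {An : MorphismProperty C} {X Y : C} (hY : IsFibrantObj An Y)
    {p : X ⟶ Y} (hp : IsFib An p) : IsFibrantObj An X := by
  intro A B f hf a
  obtain ⟨b, hb⟩ := hY f hf (a ≫ p)
  have := hp f hf
  have sq : CommSq a f p b := ⟨hb.symm⟩
  exact ⟨sq.lift, sq.fac_left⟩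

namespace Cylinder

variable (E : Cylinder C)

lemma d0_map_assoc {X Y Z : C} (f : X ⟶ Y) (h : E.I.obj Y ⟶ Z) :
    E.d0.app X ≫ E.I.map f ≫ h = f ≫ E.d0.app Y ≫ h := by
  rw [← Category.assoc, ← E.d0_naturality', Category.assoc]

lemma d1_map_assoc {X Y Z : C} (f : X ⟶ Y) (h : E.I.obj Y ⟶ Z) :
    E.d1.app X ≫ E.I.map f ≫ h = f ≫ E.d1.app Y ≫ h := by
  rw [← Category.assoc, ← E.d1_naturality', Category.assoc]

lemma d0_σ_assoc {X Y : C} (f : X ⟶ Y) : E.d0.app X ≫ E.σ.app X ≫ f = f := by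
  rw [← Category.assoc, E.d0_σ]; exact Category.id_comp f

lemma d1_σ_assoc {X Y : C} (f : X ⟶ Y) : E.d1.app X ≫ E.σ.app X ≫ f = f := by
  rw [← Category.assoc, E.d1_σ]; exact Category.id_comp f

lemma map_σ {X Y : C} (f : X ⟶ Y) : E.I.map f ≫ E.σ.app Y = E.σ.app X ≫ f := by
  simp

section

variable [HasColimits C]

lemma inl_ι (X : C) : coprod.inl ≫ E.ι X = E.d0.app X :=
  coprod.inl_desc _ _

lemma inr_ι (X : C) : coprod.inr ≫ E.ι X = E.d1.app X :=
  coprod.inr_desc _ _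

lemma inl_boundaryBox_assoc {K M W : C} (f : K ⟶ M) (h : E.I.obj M ⟶ W) :
    pushout.inl (coprod.map f f) (E.ι K) ≫ E.boundaryBox f ≫ h = E.ι M ≫ h :=
  pushout.inl_desc_assoc _ _ _ _

lemma inl_box1_assoc {K M W : C} (f : K ⟶ M) (h : E.I.obj M ⟶ W) :
    pushout.inl f (E.d1.app K) ≫ E.box1 f ≫ h = E.d1.app M ≫ h :=
  pushout.inl_desc_assoc _ _ _ _

lemma inr_box1_assoc {K M W : C} (f : K ⟶ M) (h : E.I.obj M ⟶ W) :
    pushout.inr f (E.d1.app K) ≫ E.box1 f ≫ h = E.I.map f ≫ h :=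
  pushout.inr_desc_assoc _ _ _ _

end

variable {E}

lemma Homotopy.refl {X Y : C} (f : X ⟶ Y) : E.Homotopy f f :=
  ⟨E.σ.app X ≫ f, E.d0_σ_assoc f, E.d1_σ_assoc f⟩

lemma Homotopy.precomp {X Y Z : C} {f g : Y ⟶ Z} (h : E.Homotopy f g) (a : X ⟶ Y) :
    E.Homotopy (a ≫ f) (a ≫ g) := by
  obtain ⟨h, rfl, rfl⟩ := h
  exact ⟨E.I.map a ≫ h, E.d0_map_assoc a h, E.d1_map_assoc a h⟩

lemma Homotopy.postcomp {X Y Z : C} {f g : X ⟶ Y} (h : E.Homotopy f g) (b : Y ⟶ Z) :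
    E.Homotopy (f ≫ b) (g ≫ b) := by
  obtain ⟨h, rfl, rfl⟩ := h
  exact ⟨h ≫ b, (Category.assoc _ _ _).symm, (Category.assoc _ _ _).symm⟩

lemma map_coprod_hom_ext [HasColimits C] [PreservesColimits E.I] {X Y W : C}
    {f g : E.I.obj (X ⨿ Y) ⟶ W}
    (hl : E.I.map coprod.inl ≫ f = E.I.map coprod.inl ≫ g)
    (hr : E.I.map coprod.inr ≫ f = E.I.map coprod.inr ≫ g) : f = g :=
  BinaryCofan.IsColimit.hom_ext
    (mapIsColimitOfPreservesOfIsColimit E.I _ _ (coprodIsCoprod X Y)) hl hr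

lemma exists_map_coprod_desc [HasColimits C] [PreservesColimits E.I] {X Y W : C}
    (f : E.I.obj X ⟶ W) (g : E.I.obj Y ⟶ W) :
    ∃ b : E.I.obj (X ⨿ Y) ⟶ W, E.I.map coprod.inl ≫ b = f ∧ E.I.map coprod.inr ≫ b = g := by
  obtain ⟨b, hl, hr⟩ := BinaryCofan.IsColimit.desc'
    (mapIsColimitOfPreservesOfIsColimit E.I _ _ (coprodIsCoprod X Y)) f g
  exact ⟨b, hl, hr⟩

end Cylinder

section RightAnodyne

open Cylinder

variable [HasColimits C] {E : Cylinder C} {L An : MorphismProperty C}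

lemma IsRightAnodyneClass.exists_lift_box1 (hAn : IsRightAnodyneClass E L An)
    {K M : C} {f : K ⟶ M} (hf : L f) {X Y : C} {p : X ⟶ Y} (hp : IsFib An p)
    {a : M ⟶ X} {b : E.I.obj K ⟶ X} {c : E.I.obj M ⟶ Y}
    (hab : f ≫ a = E.d1.app K ≫ b) (hac : E.d1.app M ≫ c = a ≫ p)
    (hbc : E.I.map f ≫ c = b ≫ p) :
    ∃ l : E.I.obj M ⟶ X, E.d1.app M ≫ l = a ∧ E.I.map f ≫ l = b ∧ l ≫ p = c := by
  have := hp _ (hAn.box1_mem f hf)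
  have sq : CommSq (pushout.desc a b hab) (E.box1 f) p c :=
    ⟨by
      apply pushout.hom_ext
      · rw [E.inl_box1_assoc, hac]; exact pushout.inl_desc_assoc _ _ _ _
      · rw [E.inr_box1_assoc, hbc]; exact pushout.inr_desc_assoc _ _ _ _⟩
  refine ⟨sq.lift, ?_, ?_, sq.fac_right⟩
  · rw [← E.inl_box1_assoc, sq.fac_left]; exact pushout.inl_desc _ _ _
  · rw [← E.inr_box1_assoc, sq.fac_left]; exact pushout.inr_desc _ _ _

lemma IsRightAnodyneClass.exists_extension_box1 (hAn : IsRightAnodyneClass E L An)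
    {K M : C} {f : K ⟶ M} (hf : L f) {W : C} (hW : IsFibrantObj An W)
    {a : M ⟶ W} {b : E.I.obj K ⟶ W} (hab : f ≫ a = E.d1.app K ≫ b) :
    ∃ l : E.I.obj M ⟶ W, E.d1.app M ≫ l = a ∧ E.I.map f ≫ l = b := by
  obtain ⟨l, hl⟩ := hW _ (hAn.box1_mem f hf) (pushout.desc a b hab)
  refine ⟨l, ?_, ?_⟩
  · rw [← E.inl_box1_assoc, hl]; exact pushout.inl_desc _ _ _
  · rw [← E.inr_box1_assoc, hl]; exact pushout.inr_desc _ _ _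

lemma IsRightAnodyneClass.exists_lift_d1 (hAn : IsRightAnodyneClass E L An)
    (hE : IsExactCylinder E L) (hL : ∀ X : C, L (initial.to X))
    {M X Y : C} {p : X ⟶ Y} (hp : IsFib An p) {a : M ⟶ X} {c : E.I.obj M ⟶ Y}
    (hac : E.d1.app M ≫ c = a ≫ p) :
    ∃ l : E.I.obj M ⟶ X, E.d1.app M ≫ l = a ∧ l ≫ p = c := by
  have := hE.preservesColimits
  have hI : IsInitial (E.I.obj (⊥_ C)) := initialIsInitial.isInitialObj E.I
  obtain ⟨l, hl, -, hl'⟩ := hAn.exists_lift_box1 (hL M) hp (a := a) (b := hI.to X) (c := c)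
    (initialIsInitial.hom_ext _ _) hac (hI.hom_ext _ _)
  exact ⟨l, hl, hl'⟩

/-- Filling a square, over a fibration, whose face opposite to `d0` and whose two sides
are prescribed. -/
lemma IsRightAnodyneClass.exists_lift_square (hAn : IsRightAnodyneClass E L An)
    (hE : IsExactCylinder E L) {X Y Z : C} {p : Z ⟶ Y} (hp : IsFib An p)
    {h₀ h₁ u : E.I.obj X ⟶ Z} {H : E.I.obj (E.I.obj X) ⟶ Y}
    (w₀ : E.d0.app X ≫ u = E.d1.app X ≫ h₀) (w₁ : E.d1.app X ≫ u = E.d1.app X ≫ h₁)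
    (hH₀ : E.I.map (E.d0.app X) ≫ H = h₀ ≫ p) (hH₁ : E.I.map (E.d1.app X) ≫ H = h₁ ≫ p)
    (hHu : E.d1.app (E.I.obj X) ≫ H = u ≫ p) :
    ∃ G : E.I.obj (E.I.obj X) ⟶ Z, E.I.map (E.d0.app X) ≫ G = h₀ ∧
      E.I.map (E.d1.app X) ≫ G = h₁ ∧ G ≫ p = H := by
  have := hE.preservesColimits
  obtain ⟨b, hb₀, hb₁⟩ := exists_map_coprod_desc h₀ h₁
  obtain ⟨G, -, hG, hGp⟩ := hAn.exists_lift_box1 (hE.ι_mem X) hp (a := u) (b := b) (c := H)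
    (by
      apply coprod.hom_ext
      · rw [← Category.assoc, E.inl_ι, ← E.d1_map_assoc, hb₀]; exact w₀
      · rw [← Category.assoc, E.inr_ι, ← E.d1_map_assoc, hb₁]; exact w₁) hHu
    (by
      apply map_coprod_hom_ext
      · rw [← Category.assoc, ← E.I.map_comp, E.inl_ι, ← Category.assoc, hb₀]; exact hH₀
      · rw [← Category.assoc, ← E.I.map_comp, E.inr_ι, ← Category.assoc, hb₁]; exact hH₁)
  refine ⟨G, ?_, ?_, hGp⟩
  · rw [← hb₀, ← hG, ← Category.assoc, ← E.I.map_comp, E.inl_ι]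
  · rw [← hb₁, ← hG, ← Category.assoc, ← E.I.map_comp, E.inr_ι]

lemma IsRightAnodyneClass.homotopy_of_square (hAn : IsRightAnodyneClass E L An)
    (hE : IsExactCylinder E L) {X W : C} (hW : IsFibrantObj An W) {f f' g g' : X ⟶ W}
    (hf : E.Homotopy f f') (hg : E.Homotopy g g') (hu : E.Homotopy f' g') :
    E.Homotopy f g := by
  have := hE.preservesColimits
  obtain ⟨h₀, rfl, h₀'⟩ := hf
  obtain ⟨h₁, rfl, h₁'⟩ := hg
  obtain ⟨u, hu₀, hu₁⟩ := hu
  obtain ⟨b, hb₀, hb₁⟩ := exists_map_coprod_desc h₀ h₁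
  obtain ⟨G, -, hG⟩ := hAn.exists_extension_box1 (hE.ι_mem X) hW (a := u) (b := b) (by
    apply coprod.hom_ext
    · rw [← Category.assoc, E.inl_ι, ← E.d1_map_assoc, hb₀, h₀']; exact hu₀
    · rw [← Category.assoc, E.inr_ι, ← E.d1_map_assoc, hb₁, h₁']; exact hu₁)
  refine ⟨E.d0.app _ ≫ G, ?_, ?_⟩
  · rw [← hb₀, ← hG, E.d0_map_assoc, E.d0_map_assoc, ← E.inl_ι]; exact Category.assoc _ _ _
  · rw [← hb₁, ← hG, E.d0_map_assoc, E.d0_map_assoc, ← E.inr_ι]; exact Category.assoc _ _ _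

lemma IsRightAnodyneClass.equivalence_homotopy (hAn : IsRightAnodyneClass E L An)
    (hE : IsExactCylinder E L) (X : C) {W : C} (hW : IsFibrantObj An W) :
    Equivalence (fun f g : X ⟶ W ↦ E.Homotopy f g) := by
  have hsymm {f g : X ⟶ W} (h : E.Homotopy f g) : E.Homotopy g f :=
    hAn.homotopy_of_square hE hW (.refl g) h (.refl g)
  exact ⟨.refl, hsymm, fun h h' ↦ hAn.homotopy_of_square hE hW h (hsymm h') (.refl _)⟩

lemma IsRightAnodyneClass.mk_eq_mk_iff (hAn : IsRightAnodyneClass E L An)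
    (hE : IsExactCylinder E L) {X W : C} (hW : IsFibrantObj An W) {f g : X ⟶ W} :
    (Quot.mk _ f : E.HoHom X W) = Quot.mk _ g ↔ E.Homotopy f g :=
  ⟨fun h ↦ (hAn.equivalence_homotopy hE X hW).eqvGen_iff.1 (Quot.eqvGen_exact h),
    fun h ↦ Quot.sound h⟩

/-- A right anodyne extension is a weak equivalence. -/
lemma IsRightAnodyneClass.isWeakEq (hAn : IsRightAnodyneClass E L An)
    (hE : IsExactCylinder E L) {K M : C} {i : K ⟶ M} (hi : An i) : IsWeakEq E An i := by
  refine fun W hW ↦ ⟨?_, ?_⟩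
  · rintro ⟨f⟩ ⟨g⟩ h
    obtain ⟨h, h₀, h₁⟩ := (hAn.mk_eq_mk_iff hE hW).1 h
    obtain ⟨l, hl⟩ := hW _ (hAn.boundaryBox_mem i hi) (pushout.desc (coprod.desc f g) h (by
      apply coprod.hom_ext
      · rw [← Category.assoc _ (E.ι K), E.inl_ι, h₀, coprod.inl_map_assoc, coprod.inl_desc]
      · rw [← Category.assoc _ (E.ι K), E.inr_ι, h₁, coprod.inr_map_assoc, coprod.inr_desc]))
    have hl' : E.ι M ≫ l = coprod.desc f g := by
      rw [← E.inl_boundaryBox_assoc, hl]; exact pushout.inl_desc _ _ _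
    refine Quot.sound ⟨l, ?_, ?_⟩
    · rw [← E.inl_ι, Category.assoc, hl', coprod.inl_desc]
    · rw [← E.inr_ι, Category.assoc, hl', coprod.inr_desc]
  · rintro ⟨f⟩
    obtain ⟨g, rfl⟩ := hW i hi f
    exact ⟨Quot.mk _ g, rfl⟩

/-- If `s` is a section up to homotopy of a fibration `p` between fibrant objects and `p ≫ s` is
homotopic to the identity, then `p` has a section which is the inverse of `p` up to
a homotopy over the base. -/
lemma IsRightAnodyneClass.exists_fiberwise_deformation (hAn : IsRightAnodyneClass E L An)
    (hE : IsExactCylinder E L) (hL : ∀ X : C, L (initial.to X)) {N M : C} {p : N ⟶ M}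
    (hM : IsFibrantObj An M) (hp : IsFib An p) {s : M ⟶ N}
    (hsp : E.Homotopy (s ≫ p) (𝟙 M)) (hps : E.Homotopy (p ≫ s) (𝟙 N)) :
    ∃ (s' : M ⟶ N) (G : E.I.obj N ⟶ N), s' ≫ p = 𝟙 M ∧ E.d0.app N ≫ G = 𝟙 N ∧
      E.d1.app N ≫ G = p ≫ s' ∧ G ≫ p = E.σ.app N ≫ p := by
  have hN := hM.of_isFib hp
  obtain ⟨H, hH₀, hH₁⟩ := (hAn.equivalence_homotopy hE M hM).symm hsp
  obtain ⟨l, hl, hlp⟩ := hAn.exists_lift_d1 hE hL hp hH₁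
  obtain ⟨s', hs'⟩ : ∃ s' : M ⟶ N, E.d0.app M ≫ l = s' := ⟨_, rfl⟩
  have hs'p : s' ≫ p = 𝟙 M := by
    rw [← hs', Category.assoc, hlp]; exact hH₀
  have hs's : E.Homotopy s' s := ⟨l, hs', hl⟩
  obtain ⟨k, hk₀, hk₁⟩ := (hAn.equivalence_homotopy hE N hN).symm
    ((hAn.equivalence_homotopy hE N hN).trans (hs's.precomp p) hps)
  obtain ⟨G, hG₀, hG₁, hGp⟩ := hAn.exists_lift_square hE hp (h₀ := k) (h₁ := k ≫ p ≫ s')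
    (u := E.σ.app N ≫ p ≫ s') (H := E.I.map (E.σ.app N) ≫ k ≫ p)
    (by rw [hk₁, E.d0_σ_assoc])
    (by
      rw [← Category.assoc _ k, hk₁, Category.assoc, ← Category.assoc s', hs'p,
        Category.id_comp, E.d1_σ_assoc])
    (by rw [← Category.assoc, ← E.I.map_comp, E.d0_σ]; simp)
    (by rw [← Category.assoc, ← E.I.map_comp, E.d1_σ]; simp [hs'p])
    (by
      have := hk₁ =≫ p
      simp only [Category.assoc, hs'p] at this ⊢
      exact (E.d1_map_assoc _ _).trans (congrArg _ this))
  refine ⟨s', E.d0.app _ ≫ G, hs'p, ?_, ?_, ?_⟩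
  · rw [← hk₀, ← hG₀, E.d0_map_assoc]
  · have : E.d0.app N ≫ k ≫ p ≫ s' = p ≫ s' := by
      rw [← Category.assoc, hk₀]; exact Category.id_comp _
    rw [← this, ← hG₁, E.d0_map_assoc]
  · have := hk₀ =≫ p
    rw [Category.assoc] at this
    rw [Category.assoc, hGp]
    exact (E.d0_map_assoc _ _).trans (congrArg _ (this.trans (Category.id_comp p)))

lemma IsRightAnodyneClass.of_isWeakEq_of_factorization (hAn : IsRightAnodyneClass E L An)
    (hE : IsExactCylinder E L) (hL : ∀ X : C, L (initial.to X)) {K M N : C} {i : K ⟶ M}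
    (hi : L i) (hM : IsFibrantObj An M) (hw : IsWeakEq E An i) {j : K ⟶ N} {p : N ⟶ M}
    (hj : An j) (hp : IsFib An p) (hjp : j ≫ p = i) : An i := by
  have hN := hM.of_isFib hp
  obtain ⟨⟨s⟩, hs⟩ := (hw N hN).2 (Quot.mk _ j)
  replace hs : E.Homotopy (i ≫ s) j := (hAn.mk_eq_mk_iff hE hN).1 hs
  have hsp : E.Homotopy (s ≫ p) (𝟙 M) := (hAn.mk_eq_mk_iff hE hM).1 ((hw M hM).1
    (Quot.sound (by simpa [hjp] using hs.postcomp p)))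
  have hps : E.Homotopy (p ≫ s) (𝟙 N) := (hAn.mk_eq_mk_iff hE hN).1
    ((hAn.isWeakEq hE hj N hN).1
      (Quot.sound (by simpa [← Category.assoc, hjp] using hs)))
  obtain ⟨s', G, hs'p, hG₀, hG₁, hGp⟩ :=
    hAn.exists_fiberwise_deformation hE hL hM hp hsp hps
  obtain ⟨l, hl₁, hl, hlp⟩ := hAn.exists_lift_box1 hi hp (a := s') (b := E.I.map j ≫ G)
    (c := E.σ.app M)
    (by rw [E.d1_map_assoc, hG₁, ← Category.assoc, hjp])
    (by rw [E.d1_σ, hs'p])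
    (by rw [Category.assoc, hGp, ← Category.assoc, E.map_σ, E.map_σ, Category.assoc, hjp])
  refine hAn.of_retract hj hjp (t := E.d0.app M ≫ l) ?_ ?_
  · rw [← E.d0_map_assoc, hl, E.d0_map_assoc, hG₀]; exact Category.comp_id j
  · rw [Category.assoc, hlp, E.d0_σ]

end RightAnodyne

/-- Lemma 2.27 (fibranttarget): a morphism of `L` with right `I`-fibrant codomain is a weak
equivalence iff it is a right `I`-anodyne extension. -/
theorem statement_8    {C : Type u} [Category.{v} C] [LocallyPresentable C]
    (L R : MorphismProperty C) (hW : IsCofGenWFS L R)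
    (E : Cylinder C) (hE : IsExactCylinder E L)
    (An : MorphismProperty C) (hAn : IsRightAnodyneClass E L An)
    ⦃K M : C⦄ (i : K ⟶ M) (hi : L i) (hM : IsFibrantObj An M) :
    IsWeakEq E An i ↔ An i := by
  refine ⟨fun hw ↦ ?_, hAn.isWeakEq hE⟩
  obtain ⟨N, j, p, hj, hp, hjp⟩ := hAn.exists_factorization i
  exact hAn.of_isWeakEq_of_factorization hE hW.initial_mem hi hM hw hj hp hjp

end Paper
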